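/- Sharpness of the maximal estimate (Proposition 3.6): let T ∈ (0,1), α ≥ 0 and s ∈ ℝ, and suppose there exists C>0 such that for every Schwartz function φ on ℝ³, ( ∫_ℝ ( sup_{(y,z)∈ℝ², t∈[0,T]} t^α |U(t)φ(x,y,z)| )² dx )^{1/2} ≤ C ‖φ‖_{H^s(ℝ³)}. Then s ≥ 1. -/

import Mathlib

open MeasureTheory Real Filter
open scoped ENNReal

noncomputable section

/-- Euclidean dot product on ℝ³ (realized as ℝ × ℝ × ℝ). -/
def dot3 (a b : ℝ × ℝ × ℝ) : ℝ := a.1 * b.1 + a.2.1 * b.2.1 + a.2.2 * b.2.2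

/-- Euclidean norm on ℝ³. -/
def en3 (ξ : ℝ × ℝ × ℝ) : ℝ := Real.sqrt (dot3 ξ ξ)

/-- The Zakharov–Kuznetsov dispersion relation ω(ξ,η,μ) = ξ(ξ²+η²+μ²). -/
def omega3 (ξ : ℝ × ℝ × ℝ) : ℝ := ξ.1 * (ξ.1 ^ 2 + ξ.2.1 ^ 2 + ξ.2.2 ^ 2)

/-- Fourier transform on ℝ³, with normalization (2π)⁻³ ∫ e^{-i x·ξ} φ(x) dx. -/
def FT3 (φ : ℝ × ℝ × ℝ → ℂ) (ξ : ℝ × ℝ × ℝ) : ℂ :=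
  ((((2 * π) ^ 3)⁻¹ : ℝ) : ℂ) * ∫ x : ℝ × ℝ × ℝ, Complex.exp (-Complex.I * (dot3 x ξ : ℂ)) * φ x

/-- Inverse Fourier transform on ℝ³: ∫ e^{i x·ξ} g(ξ) dξ. -/
def invFT3 (g : ℝ × ℝ × ℝ → ℂ) (x : ℝ × ℝ × ℝ) : ℂ :=
  ∫ ξ : ℝ × ℝ × ℝ, Complex.exp (Complex.I * (dot3 x ξ : ℂ)) * g ξ

/-- The free Zakharov–Kuznetsov evolution U(t)φ(x̄) = ∫ e^{i(x̄·ξ̄ + tω(ξ̄))} φ̂(ξ̄) dξ̄. -/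
def U3 (φ : ℝ × ℝ × ℝ → ℂ) (t : ℝ) (x : ℝ × ℝ × ℝ) : ℂ :=
  ∫ ξ : ℝ × ℝ × ℝ, Complex.exp (Complex.I * ((dot3 x ξ + t * omega3 ξ : ℝ) : ℂ)) * FT3 φ ξ

/-- L² norm on ℝ³. -/
def L2norm3 (φ : ℝ × ℝ × ℝ → ℂ) : ℝ := Real.sqrt (∫ x : ℝ × ℝ × ℝ, ‖φ x‖ ^ 2)

/-- j-th coordinate of a point of ℝ³. -/
def coord3 (j : Fin 3) (ξ : ℝ × ℝ × ℝ) : ℝ := ![ξ.1, ξ.2.1, ξ.2.2] j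

/-- Littlewood–Paley ring cutoff δ_k(ξ̄) = p(2^{-k-1}ξ̄) − p(2^{-k}ξ̄) on ℝ³. -/
def delta3 (p : ℝ × ℝ × ℝ → ℝ) (k : ℤ) (ξ : ℝ × ℝ × ℝ) : ℝ :=
  p ((2:ℝ) ^ (-k-1) • ξ) - p ((2:ℝ) ^ (-k) • ξ)

/-- 1D rescaled cutoff p_k(ξ) = p(2^{-k}ξ). -/
def pk1 (p : ℝ → ℝ) (k : ℤ) (ξ : ℝ) : ℝ := p ((2:ℝ) ^ (-k) * ξ)

/-- 1D ring cutoff δ_k(ξ) = p(2^{-k-1}ξ) − p(2^{-k}ξ). -/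
def dk1 (p : ℝ → ℝ) (k : ℤ) (ξ : ℝ) : ℝ := p ((2:ℝ) ^ (-k-1) * ξ) - p ((2:ℝ) ^ (-k) * ξ)

/-- Oscillatory integral I with three 1D symbols:
I(t,x̄) = ∫ e^{i(x̄·ξ̄+tω(ξ̄))} ψ₁(ξ)ψ₂(η)ψ₃(μ) dξ̄. -/
def oscI (ψ₁ ψ₂ ψ₃ : ℝ → ℝ) (t : ℝ) (x : ℝ × ℝ × ℝ) : ℂ :=
  ∫ ξ : ℝ × ℝ × ℝ, Complex.exp (Complex.I * ((dot3 x ξ + t * omega3 ξ : ℝ) : ℂ)) *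
    ((ψ₁ ξ.1 * ψ₂ ξ.2.1 * ψ₃ ξ.2.2 : ℝ) : ℂ)

/-- The H^s norm ‖(1+|ξ̄|²)^{s/2} φ̂‖_{L²}. -/
def HsNorm (s : ℝ) (φ : ℝ × ℝ × ℝ → ℂ) : ℝ :=
  Real.sqrt (∫ ξ : ℝ × ℝ × ℝ, (1 + dot3 ξ ξ) ^ s * ‖FT3 φ ξ‖ ^ 2)

open scoped FourierTransform SchwartzMap

instance isAddHaarMeasure_volume_prod₃ : (volume : Measure (ℝ × ℝ × ℝ)).IsAddHaarMeasure :=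
  have : (volume : Measure (ℝ × ℝ)).IsAddHaarMeasure :=
    Measure.prod.instIsAddHaarMeasure volume volume
  Measure.prod.instIsAddHaarMeasure volume volume

/-- `ℝ³` with its Euclidean norm. -/
abbrev Euclid3 : Type := WithLp 2 (ℝ × WithLp 2 (ℝ × ℝ))

/-- The identification of Euclidean space with `ℝ × ℝ × ℝ`. -/
def euclid3Equiv : Euclid3 ≃L[ℝ] ℝ × ℝ × ℝ :=
  (WithLp.prodContinuousLinearEquiv 2 ℝ ℝ (WithLp 2 (ℝ × ℝ))).trans
    ((ContinuousLinearEquiv.refl ℝ ℝ).prodCongr (WithLp.prodContinuousLinearEquiv 2 ℝ ℝ ℝ))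

lemma measurePreserving_euclid3Equiv : MeasurePreserving euclid3Equiv :=
  ((MeasurePreserving.id volume).prod (WithLp.volume_preserving_ofLp ℝ ℝ)).comp
    (WithLp.volume_preserving_ofLp ℝ (WithLp 2 (ℝ × ℝ)))

lemma inner_eq_dot3 (u v : Euclid3) :
    inner ℝ u v = dot3 (euclid3Equiv u) (euclid3Equiv v) := by
  simp [dot3, euclid3Equiv, WithLp.prod_inner_apply]
  ring

lemma dot3_smul_left (c : ℝ) (a b : ℝ × ℝ × ℝ) : dot3 (c • a) b = c * dot3 a b := by
  simp [dot3]; ring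

/-- Every Schwartz function is the Fourier transform of a Schwartz function. -/
lemma exists_FT3_eq (g : 𝓢(ℝ × ℝ × ℝ, ℂ)) : ∃ φ : 𝓢(ℝ × ℝ × ℝ, ℂ), ∀ ξ, FT3 φ ξ = g ξ := by
  have hpi : (2 * π : ℝ) ≠ 0 := by positivity
  set g' : 𝓢(Euclid3, ℂ) := SchwartzMap.compCLMOfContinuousLinearEquiv ℂ euclid3Equiv g with hg'
  set ψ : 𝓢(Euclid3, ℂ) := 𝓕⁻ g' with hψ
  let M : (ℝ × ℝ × ℝ) ≃L[ℝ] Euclid3 :=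
    (ContinuousLinearEquiv.smulLeft (Units.mk0 (2 * π : ℝ)⁻¹ (inv_ne_zero hpi))).trans
      euclid3Equiv.symm
  have hM (x) : M x = euclid3Equiv.symm ((2 * π : ℝ)⁻¹ • x) := rfl
  refine ⟨SchwartzMap.compCLMOfContinuousLinearEquiv ℂ M ψ, fun ξ ↦ ?_⟩
  let F : ℝ × ℝ × ℝ → ℂ := fun u ↦
    Complex.exp (-Complex.I * ((2 * π * dot3 u ξ : ℝ) : ℂ)) * ψ (euclid3Equiv.symm u)
  have h1 : ∫ x : ℝ × ℝ × ℝ, Complex.exp (-Complex.I * (dot3 x ξ : ℂ)) *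
      (SchwartzMap.compCLMOfContinuousLinearEquiv ℂ M ψ) x
      = ∫ x : ℝ × ℝ × ℝ, F ((2 * π : ℝ)⁻¹ • x) := by
    congr 1 with x
    simp only [F, dot3_smul_left, SchwartzMap.compCLMOfContinuousLinearEquiv_apply,
      Function.comp, hM]
    rw [mul_inv_cancel_left₀ hpi]
  have h2 : ∫ u, F u = ∫ v, F (euclid3Equiv v) :=
    (measurePreserving_euclid3Equiv.integral_comp
      euclid3Equiv.toHomeomorph.measurableEmbedding F).symm
  have h3 : ∫ v, F (euclid3Equiv v) = 𝓕 (ψ : Euclid3 → ℂ) (euclid3Equiv.symm ξ) := by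
    rw [Real.fourier_eq']
    congr 1 with v
    simp only [F, inner_eq_dot3, smul_eq_mul, ContinuousLinearEquiv.apply_symm_apply,
      ContinuousLinearEquiv.symm_apply_apply]
    congr 2
    push_cast
    ring
  have h4 : 𝓕 (ψ : Euclid3 → ℂ) (euclid3Equiv.symm ξ) = g ξ := by
    rw [← SchwartzMap.fourier_coe, hψ, FourierTransform.fourier_fourierInv_eq, hg']
    simp
  rw [FT3, h1, Measure.integral_comp_inv_smul, h2, h3, h4]
  have : Module.finrank ℝ (ℝ × ℝ × ℝ) = 3 := by simp
  rw [this, abs_of_pos (by positivity), Complex.real_smul, ← mul_assoc, ← Complex.ofReal_mul,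
    inv_mul_cancel₀ (by positivity)]
  simp

lemma continuous_dot3 : Continuous fun p : (ℝ × ℝ × ℝ) × (ℝ × ℝ × ℝ) ↦ dot3 p.1 p.2 := by
  unfold dot3; fun_prop

lemma contDiff_omega3 : ContDiff ℝ ⊤ omega3 := by
  unfold omega3; fun_prop

/-- The oscillatory integral with amplitude `f`. -/
def zkOsc (f : ℝ × ℝ × ℝ → ℝ) (τ : ℝ) (x : ℝ × ℝ × ℝ) : ℂ :=
  ∫ ξ : ℝ × ℝ × ℝ, Complex.exp (Complex.I * ((dot3 x ξ + τ * omega3 ξ : ℝ) : ℂ)) * (f ξ : ℂ)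

lemma norm_exp_I_mul_mul (a : ℝ) (b : ℂ) : ‖Complex.exp (Complex.I * (a : ℂ)) * b‖ = ‖b‖ := by
  rw [norm_mul, mul_comm Complex.I, Complex.norm_exp_ofReal_mul_I, one_mul]

lemma norm_zkOsc_le (f : ℝ × ℝ × ℝ → ℝ) (τ : ℝ) (x : ℝ × ℝ × ℝ) :
    ‖zkOsc f τ x‖ ≤ ∫ ξ, |f ξ| := by
  refine (norm_integral_le_integral_norm _).trans_eq ?_
  simp only [norm_exp_I_mul_mul, Complex.norm_real, Real.norm_eq_abs]

lemma continuous_zkOsc {f : ℝ × ℝ × ℝ → ℝ} (hf : Continuous f) (hfi : Integrable f) (τ : ℝ) :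
    Continuous (zkOsc f τ) := by
  have hω := contDiff_omega3.continuous
  have hd := continuous_dot3
  refine continuous_of_dominated (bound := fun ξ ↦ |f ξ|) (fun x ↦ ?_) (fun x ↦ ?_) hfi.abs ?_
  · have : Continuous fun ξ ↦ dot3 x ξ := hd.comp (by fun_prop : Continuous fun ξ ↦ (x, ξ))
    exact Continuous.aestronglyMeasurable (by fun_prop)
  · simp only [norm_exp_I_mul_mul, Complex.norm_real, Real.norm_eq_abs, le_refl,
      Filter.eventually_true]
  · refine Filter.Eventually.of_forall fun ξ ↦ ?_
    have : Continuous fun x ↦ dot3 x ξ := hd.comp (by fun_prop : Continuous fun x ↦ (x, ξ))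
    fun_prop

/-- Integrating by parts in the first frequency variable gains decay in the first
space variable. -/
lemma abs_mul_norm_zkOsc_le {f : ℝ × ℝ × ℝ → ℝ} (hf : ContDiff ℝ 1 f) (hfc : HasCompactSupport f)
    {τ : ℝ} (hτ : |τ| ≤ 1) (x : ℝ × ℝ × ℝ) :
    |x.1| * ‖zkOsc f τ x‖ ≤
      ∫ ξ, |fderiv ℝ f ξ (1, 0, 0)| + |(3 * ξ.1 ^ 2 + ξ.2.1 ^ 2 + ξ.2.2 ^ 2) * f ξ| := by
  set v : ℝ × ℝ × ℝ := (1, 0, 0)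
  set q : ℝ × ℝ × ℝ → ℝ := fun ξ ↦ 3 * ξ.1 ^ 2 + ξ.2.1 ^ 2 + ξ.2.2 ^ 2 with hq
  set P : ℝ × ℝ × ℝ → ℝ := fun ξ ↦ dot3 x ξ + τ * omega3 ξ with hP
  set e : ℝ × ℝ × ℝ → ℂ := fun ξ ↦ Complex.exp (Complex.I * (P ξ : ℂ))
  have hPd : ContDiff ℝ ⊤ P := by
    rw [hP]; unfold dot3 omega3; fun_prop
  have hPv (ξ) : HasLineDerivAt ℝ P (x.1 + τ * q ξ) ξ v := by
    unfold HasLineDerivAt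
    have h : HasDerivAt (fun t : ℝ ↦ ξ.1 + t) 1 0 := (hasDerivAt_id' (0 : ℝ)).const_add _
    have h2 := ((h.const_mul x.1).add_const (x.2.1 * ξ.2.1 + x.2.2 * ξ.2.2)).add
      ((h.mul (((h.pow 2).add_const (ξ.2.1 ^ 2)).add_const (ξ.2.2 ^ 2))).const_mul τ)
    convert h2 using 1
    · ext t
      simp [P, dot3, omega3, v]
      ring
    · simp only [q, Pi.pow_apply]; push_cast; ring
  have hev (ξ) : HasLineDerivAt ℝ e (e ξ * (Complex.I * ((x.1 + τ * q ξ : ℝ) : ℂ))) ξ v := by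
    have h := ((hPv ξ).ofReal_comp.const_mul Complex.I).cexp
    simpa [HasLineDerivAt, e] using h
  have hfv (ξ) : HasLineDerivAt ℝ (fun ξ ↦ (f ξ : ℂ)) ((fderiv ℝ f ξ v : ℝ) : ℂ) ξ v :=
    (((hf.differentiable one_ne_zero) ξ).hasFDerivAt.hasLineDerivAt v).ofReal_comp
  have hec : Continuous e := by have := hPd.continuous; fun_prop
  have hfcont := hf.continuous
  have hdc : Continuous fun ξ ↦ fderiv ℝ f ξ v :=
    (hf.continuous_fderiv one_ne_zero).clm_apply continuous_const
  have hdcs : HasCompactSupport fun ξ ↦ fderiv ℝ f ξ v := hfc.fderiv_apply ℝ v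
  have hfC : HasCompactSupport fun ξ ↦ (f ξ : ℂ) := hfc.comp_left (g := ((↑) : ℝ → ℂ)) (by simp)
  have hdC : HasCompactSupport fun ξ ↦ ((fderiv ℝ f ξ v : ℝ) : ℂ) :=
    hdcs.comp_left (g := ((↑) : ℝ → ℂ)) (by simp)
  have hqc : Continuous q := by rw [hq]; fun_prop
  have i1 : Integrable fun ξ ↦ e ξ * (f ξ : ℂ) :=
    Continuous.integrable_of_hasCompactSupport (by fun_prop) hfC.mul_left
  have i2 : Integrable fun ξ ↦ e ξ * ((fderiv ℝ f ξ v : ℝ) : ℂ) :=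
    Continuous.integrable_of_hasCompactSupport (by fun_prop) hdC.mul_left
  have i3 : Integrable fun ξ ↦ e ξ * (Complex.I * ((x.1 + τ * q ξ : ℝ) : ℂ)) * (f ξ : ℂ) :=
    Continuous.integrable_of_hasCompactSupport (by fun_prop) hfC.mul_left
  have i4 : Integrable fun ξ ↦ e ξ * ((τ * q ξ * f ξ : ℝ) : ℂ) := by
    refine Continuous.integrable_of_hasCompactSupport (by fun_prop) ?_
    exact HasCompactSupport.mul_left
      ((hfc.mul_left (f := fun ξ ↦ τ * q ξ)).comp_left (g := ((↑) : ℝ → ℂ)) (by simp))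
  have ibp := integral_bilinear_hasLineDerivAt_right_eq_neg_left_of_integrable
    (B := ContinuousLinearMap.mul ℝ ℂ) (μ := volume) (v := v) i3 i2 i1
    (fun ξ _ ↦ hev ξ) (fun ξ _ ↦ hfv ξ)
  simp only [ContinuousLinearMap.mul_apply'] at ibp
  have key : (x.1 : ℂ) * zkOsc f τ x = ∫ ξ, (Complex.I * (e ξ * ((fderiv ℝ f ξ v : ℝ) : ℂ))
      - e ξ * ((τ * q ξ * f ξ : ℝ) : ℂ)) := by
    have h3 : (fun ξ ↦ e ξ * (Complex.I * ((x.1 + τ * q ξ : ℝ) : ℂ)) * (f ξ : ℂ)) =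
        fun ξ ↦ Complex.I * ((x.1 : ℂ) * (e ξ * (f ξ : ℂ)) + e ξ * ((τ * q ξ * f ξ : ℝ) : ℂ)) := by
      ext ξ; push_cast; ring
    rw [h3, integral_const_mul, integral_add (i1.const_mul _) i4, integral_const_mul] at ibp
    rw [integral_sub (i2.const_mul _) i4, integral_const_mul, ibp]
    have : zkOsc f τ x = ∫ ξ, e ξ * (f ξ : ℂ) := rfl
    rw [this]
    linear_combination ((x.1 : ℂ) * (∫ ξ, e ξ * (f ξ : ℂ)) +
      ∫ ξ, e ξ * ((τ * q ξ * f ξ : ℝ) : ℂ)) * Complex.I_mul_I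
  rw [← Real.norm_eq_abs, ← Complex.norm_real, ← norm_mul, key]
  refine norm_integral_le_of_norm_le ?_ (Filter.Eventually.of_forall fun ξ ↦ ?_)
  · exact (hdc.integrable_of_hasCompactSupport hdcs).abs.add
      ((hqc.mul hfcont).integrable_of_hasCompactSupport hfc.mul_left).abs
  · refine (norm_sub_le _ _).trans (add_le_add ?_ ?_)
    · rw [norm_mul, Complex.norm_I, one_mul, norm_exp_I_mul_mul, Complex.norm_real,
        Real.norm_eq_abs]
    · rw [norm_exp_I_mul_mul, Complex.norm_real, Real.norm_eq_abs, mul_assoc, abs_mul]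
      exact mul_le_of_le_one_left (abs_nonneg _) hτ

section Supremum

variable {ι κ ρ : Type*} [Nonempty κ] [Nonempty ρ] {F : ℝ → ι → κ → ρ → ℝ} {K : ℝ}

lemma le_ciSup₃ (hK : ∀ x i j k, F x i j k ≤ K) (x : ℝ) (i : ι) (j : κ) (k : ρ) :
    F x i j k ≤ ⨆ (i) (j) (k), F x i j k := by
  have h3 (i j) : BddAbove (Set.range fun k ↦ F x i j k) := ⟨K, by rintro _ ⟨k, rfl⟩; exact hK ..⟩
  have h2 (i) : BddAbove (Set.range fun j ↦ ⨆ k, F x i j k) :=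
    ⟨K, by rintro _ ⟨j, rfl⟩; exact ciSup_le fun k ↦ hK ..⟩
  have h1 : BddAbove (Set.range fun i ↦ ⨆ (j) (k), F x i j k) :=
    ⟨K, by rintro _ ⟨i, rfl⟩; exact ciSup_le fun j ↦ ciSup_le fun k ↦ hK ..⟩
  exact (le_ciSup (h3 i j) k).trans ((le_ciSup (h2 i) j).trans (le_ciSup h1 i))

lemma measurable_ciSup₃ (hK : ∀ x i j k, F x i j k ≤ K)
    (hF : ∀ i j k, Continuous fun x ↦ F x i j k) :
    Measurable fun x ↦ ⨆ (i) (j) (k), F x i j k := by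
  refine LowerSemicontinuous.measurable (lowerSemicontinuous_ciSup (fun x ↦ ?_) fun i ↦
    lowerSemicontinuous_ciSup (fun x ↦ ?_) fun j ↦ lowerSemicontinuous_ciSup (fun x ↦ ?_) fun k ↦
      (hF i j k).lowerSemicontinuous)
  · exact ⟨K, by rintro _ ⟨i, rfl⟩; exact ciSup_le fun j ↦ ciSup_le fun k ↦ hK ..⟩
  · exact ⟨K, by rintro _ ⟨j, rfl⟩; exact ciSup_le fun k ↦ hK ..⟩
  · exact ⟨K, by rintro _ ⟨k, rfl⟩; exact hK ..⟩

variable [Nonempty ι] in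
lemma integrable_ciSup₃_sq (h0 : ∀ x i j k, 0 ≤ F x i j k) (hK : ∀ x i j k, F x i j k ≤ K)
    (hK' : ∀ x i j k, |x| * F x i j k ≤ K) (hF : ∀ i j k, Continuous fun x ↦ F x i j k) :
    Integrable fun x ↦ (⨆ (i) (j) (k), F x i j k) ^ 2 := by
  refine ((integrable_inv_one_add_sq).const_mul (2 * K ^ 2)).mono'
    ((measurable_ciSup₃ hK hF).pow_const 2).aestronglyMeasurable
    (Filter.Eventually.of_forall fun x ↦ ?_)
  set S := ⨆ (i) (j) (k), F x i j k
  have hS0 : 0 ≤ S := Real.iSup_nonneg fun i ↦ Real.iSup_nonneg fun j ↦ Real.iSup_nonneg (h0 x i j)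
  have hS : S ≤ K := ciSup_le fun i ↦ ciSup_le fun j ↦ ciSup_le (hK x i j)
  have hS' : |x| * S ≤ K := by
    simp only [S, Real.mul_iSup_of_nonneg (abs_nonneg x)]
    exact ciSup_le fun i ↦ ciSup_le fun j ↦ ciSup_le (hK' x i j)
  rw [Real.norm_of_nonneg (sq_nonneg S), ← div_eq_mul_inv, le_div_iff₀ (by positivity)]
  have h1 : S ^ 2 ≤ K ^ 2 := pow_le_pow_left₀ hS0 hS 2
  have h2 : (|x| * S) ^ 2 ≤ K ^ 2 := pow_le_pow_left₀ (by positivity) hS' 2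
  rw [mul_pow, sq_abs] at h2
  linarith

end Supremum

lemma volume_real_closedBall_prod₃ {r : ℝ} (hr : 0 ≤ r) :
    (volume : Measure (ℝ × ℝ × ℝ)).real (Metric.closedBall 0 r) = 8 * r ^ 3 := by
  have h : Metric.closedBall (0 : ℝ × ℝ × ℝ) r =
      Metric.closedBall 0 r ×ˢ Metric.closedBall 0 r ×ˢ Metric.closedBall 0 r := by
    rw [closedBall_prod_same, closedBall_prod_same]; rfl
  rw [h, Measure.real, Measure.volume_eq_prod, Measure.prod_prod, Measure.volume_eq_prod,
    Measure.prod_prod, Real.volume_closedBall, ENNReal.toReal_mul, ENNReal.toReal_mul,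
    ENNReal.toReal_ofReal (by positivity)]
  ring

/-- Below the uncertainty scale, a nonnegative amplitude produces no cancellation. -/
lemma half_integral_le_norm_zkOsc {f : ℝ × ℝ × ℝ → ℝ} (hf : Continuous f) (hfi : Integrable f)
    (h0 : ∀ ξ, 0 ≤ f ξ) {x : ℝ} (hx : ∀ ξ, f ξ ≠ 0 → |x * ξ.1| ≤ 1) :
    (∫ ξ, f ξ) / 2 ≤ ‖zkOsc f 0 (x, 0, 0)‖ := by
  have hint : Integrable fun ξ : ℝ × ℝ × ℝ ↦
      Complex.exp (Complex.I * ((dot3 (x, 0, 0) ξ + 0 * omega3 ξ : ℝ) : ℂ)) * (f ξ : ℂ) := by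
    refine hfi.mono' (Continuous.aestronglyMeasurable ?_) (Filter.Eventually.of_forall fun ξ ↦ ?_)
    · unfold dot3 omega3; fun_prop
    · rw [norm_exp_I_mul_mul, Complex.norm_real, Real.norm_of_nonneg (h0 ξ)]
  refine le_trans ?_ (Complex.re_le_norm _)
  have hre := integral_re hint
  simp only [RCLike.re_to_complex] at hre
  rw [zkOsc, ← hre, ← integral_div]
  refine integral_mono (hfi.div_const 2) hint.re fun ξ ↦ ?_
  beta_reduce
  rw [Complex.re_mul_ofReal, mul_comm Complex.I, Complex.exp_ofReal_mul_I_re]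
  rcases eq_or_ne (f ξ) 0 with h | h
  · simp [h]
  · have h1 : (1 : ℝ) / 2 ≤ Real.cos (x * ξ.1) := by
      have := Real.one_sub_sq_div_two_le_cos (x := x * ξ.1)
      have h2 := (sq_le_one_iff_abs_le_one _).2 (hx ξ h)
      linarith
    have : dot3 (x, 0, 0) ξ + 0 * omega3 ξ = x * ξ.1 := by simp [dot3]
    rw [this]
    nlinarith [h0 ξ]

/-- The datum whose evolution focuses at the origin at time `T`. -/
lemma exists_focusing {f : ℝ × ℝ × ℝ → ℝ} (hf : ContDiff ℝ (⊤ : ℕ∞) f) (hfc : HasCompactSupport f)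
    (T : ℝ) : ∃ φ : 𝓢(ℝ × ℝ × ℝ, ℂ),
      (∀ ξ, ‖FT3 φ ξ‖ = |f ξ|) ∧ ∀ t x, U3 φ t x = zkOsc f (t - T) x := by
  let g : ℝ × ℝ × ℝ → ℂ := fun ξ ↦ Complex.exp (Complex.I * ((-T * omega3 ξ : ℝ) : ℂ)) * (f ξ : ℂ)
  have hgc : HasCompactSupport g :=
    HasCompactSupport.mul_left (hfc.comp_left (g := ((↑) : ℝ → ℂ)) (by simp))
  have hg : ContDiff ℝ (⊤ : ℕ∞) g := by
    have hω := contDiff_omega3.of_le (m := (⊤ : ℕ∞)) le_top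
    exact ((contDiff_const.mul (Complex.ofRealCLM.contDiff.comp
      (contDiff_const.mul hω))).cexp).mul (Complex.ofRealCLM.contDiff.comp hf)
  obtain ⟨φ, hφ⟩ := exists_FT3_eq (hgc.toSchwartzMap hg)
  have hφ' (ξ) : FT3 φ ξ = g ξ := hφ ξ
  refine ⟨φ, fun ξ ↦ ?_, fun t x ↦ ?_⟩
  · rw [hφ', norm_exp_I_mul_mul, Complex.norm_real, Real.norm_eq_abs]
  · unfold U3 zkOsc
    congr 1 with ξ
    rw [hφ', ← mul_assoc, ← Complex.exp_add]
    congr 2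
    push_cast
    ring

lemma integrable_iSup_sq_and_le_iSup {T α : ℝ} (hT0 : 0 < T) (hT1 : T < 1) (hα : 0 ≤ α)
    {f : ℝ × ℝ × ℝ → ℝ} (hf : ContDiff ℝ 1 f) (hfc : HasCompactSupport f)
    {u : ℝ → ℝ × ℝ × ℝ → ℂ} (hu : ∀ t x, u t x = zkOsc f (t - T) x) :
    (Integrable fun x : ℝ ↦ (⨆ (y : ℝ) (z : ℝ) (t : Set.Icc (0 : ℝ) T),
      (t : ℝ) ^ α * ‖u t (x, y, z)‖) ^ 2) ∧
    ∀ x, T ^ α * ‖zkOsc f 0 (x, 0, 0)‖ ≤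
      ⨆ (y : ℝ) (z : ℝ) (t : Set.Icc (0 : ℝ) T), (t : ℝ) ^ α * ‖u t (x, y, z)‖ := by
  have : Nonempty (Set.Icc (0 : ℝ) T) := ⟨⟨T, hT0.le, le_rfl⟩⟩
  set K₁ := ∫ ξ, |f ξ|
  set K₂ := ∫ ξ : ℝ × ℝ × ℝ,
    |fderiv ℝ f ξ (1, 0, 0)| + |(3 * ξ.1 ^ 2 + ξ.2.1 ^ 2 + ξ.2.2 ^ 2) * f ξ|
  have ht (t : Set.Icc (0 : ℝ) T) : 0 ≤ (t : ℝ) ^ α ∧ (t : ℝ) ^ α ≤ 1 :=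
    ⟨Real.rpow_nonneg t.2.1 α, Real.rpow_le_one t.2.1 (t.2.2.trans hT1.le) hα⟩
  have hK (x y z : ℝ) (t : Set.Icc (0 : ℝ) T) :
      (t : ℝ) ^ α * ‖u t (x, y, z)‖ ≤ max K₁ K₂ := by
    rw [hu]
    exact (mul_le_of_le_one_left (norm_nonneg _) (ht t).2).trans
      ((norm_zkOsc_le f _ _).trans (le_max_left _ _))
  have hK' (x y z : ℝ) (t : Set.Icc (0 : ℝ) T) :
      |x| * ((t : ℝ) ^ α * ‖u t (x, y, z)‖) ≤ max K₁ K₂ := by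
    rw [hu, mul_left_comm]
    refine (mul_le_of_le_one_left (by positivity) (ht t).2).trans
      ((abs_mul_norm_zkOsc_le hf hfc (abs_le.2 ⟨?_, ?_⟩) (x, y, z)).trans (le_max_right _ _)) <;>
    linarith [t.2.1, t.2.2]
  refine ⟨integrable_ciSup₃_sq (fun x y z t ↦ mul_nonneg (ht t).1 (norm_nonneg _)) hK hK'
    fun y z t ↦ ?_, fun x ↦ ?_⟩
  · have := (continuous_zkOsc hf.continuous (hf.continuous.integrable_of_hasCompactSupport hfc)
      (t - T)).comp (by fun_prop : Continuous fun x : ℝ ↦ (x, y, z))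
    simp only [hu]
    exact continuous_const.mul this.norm
  · have := le_ciSup₃ hK x 0 0 ⟨T, hT0.le, le_rfl⟩
    simpa [hu] using this

lemma HsNorm_sq_le {f : ℝ × ℝ × ℝ → ℝ} (hfi : Integrable f)
    (h0 : ∀ ξ, 0 ≤ f ξ) (h1 : ∀ ξ, f ξ ≤ 1) {R : ℝ}
    (hR : ∀ ξ, f ξ ≠ 0 → 1 + dot3 ξ ξ ≤ R) {φ : ℝ × ℝ × ℝ → ℂ} (hφ : ∀ ξ, ‖FT3 φ ξ‖ = |f ξ|)
    {s σ : ℝ} (hsσ : s ≤ σ) (hσ : 0 ≤ σ) :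
    HsNorm s φ ^ 2 ≤ R ^ σ * ∫ ξ, f ξ := by
  have hd (ξ) : 0 ≤ dot3 ξ ξ := by
    unfold dot3; nlinarith [sq_nonneg ξ.1, sq_nonneg ξ.2.1, sq_nonneg ξ.2.2]
  have hnn (ξ) : 0 ≤ (1 + dot3 ξ ξ) ^ s * ‖FT3 φ ξ‖ ^ 2 :=
    mul_nonneg (Real.rpow_nonneg (by linarith [hd ξ]) _) (sq_nonneg _)
  rw [HsNorm, Real.sq_sqrt (integral_nonneg hnn), ← integral_const_mul]
  refine integral_mono_of_nonneg (Filter.Eventually.of_forall hnn) (hfi.const_mul _)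
    (Filter.Eventually.of_forall fun ξ ↦ ?_)
  simp only [hφ, sq_abs]
  rcases eq_or_ne (f ξ) 0 with h | h
  · simp [h]
  · have hR' := hR ξ h
    have := hd ξ
    refine mul_le_mul ?_ (by nlinarith [h0 ξ, h1 ξ]) (sq_nonneg _)
      (Real.rpow_nonneg (by linarith) _)
    exact (Real.rpow_le_rpow_of_exponent_le (by linarith) hsσ).trans
      (Real.rpow_le_rpow (by linarith) hR' hσ)

/-- Testing the maximal estimate on a datum at frequency scale `N`. -/
lemma maximal_test {T α s σ C N : ℝ} (hT0 : 0 < T) (hT1 : T < 1) (hα : 0 ≤ α)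
    (h : ∀ φ : 𝓢(ℝ × ℝ × ℝ, ℂ),
      Real.sqrt (∫ x : ℝ, (⨆ (y : ℝ) (z : ℝ) (t : Set.Icc (0 : ℝ) T),
          (t : ℝ) ^ α * ‖U3 (⇑φ) (t : ℝ) (x, y, z)‖) ^ 2) ≤ C * HsNorm s (⇑φ))
    (hsσ : s ≤ σ) (hσ : 0 ≤ σ) (hN : 1 ≤ N) :
    (4 * N ^ 3 * T ^ α) ^ 2 * N⁻¹ ≤ C ^ 2 * ((13 * N ^ 2) ^ σ * (64 * N ^ 3)) := by
  have hN0 : 0 < N := by linarith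
  let b : ContDiffBump (0 : ℝ × ℝ × ℝ) := ⟨N, 2 * N, hN0, by linarith⟩
  have hbc := b.hasCompactSupport
  have hbi : Integrable b := b.continuous.integrable_of_hasCompactSupport hbc
  have hlow : 8 * N ^ 3 ≤ ∫ ξ, b ξ := by
    rw [← volume_real_closedBall_prod₃ hN0.le]
    exact b.measure_closedBall_le_integral volume
  have hup : ∫ ξ, b ξ ≤ 64 * N ^ 3 := by
    refine (b.integral_le_measure_closedBall volume).trans_eq ?_
    rw [volume_real_closedBall_prod₃ (by linarith : 0 ≤ 2 * N)]
    ring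
  have hsupp (ξ) (hξ : b ξ ≠ 0) : |ξ.1| ≤ 2 * N ∧ |ξ.2.1| ≤ 2 * N ∧ |ξ.2.2| ≤ 2 * N := by
    have hb : ‖ξ‖ < 2 * N := by
      by_contra! hc
      exact hξ (b.zero_of_le_dist (by simpa using hc))
    simp only [Prod.norm_def, Real.norm_eq_abs, max_lt_iff] at hb
    exact ⟨hb.1.le, hb.2.1.le, hb.2.2.le⟩
  obtain ⟨φ, hφ, hU⟩ := exists_focusing b.contDiff hbc T
  obtain ⟨hSi, hSle⟩ := integrable_iSup_sq_and_le_iSup hT0 hT1 hα b.contDiff hbc hU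
  have hHs : HsNorm s φ ^ 2 ≤ (13 * N ^ 2) ^ σ * (64 * N ^ 3) := by
    refine (HsNorm_sq_le hbi (fun _ ↦ b.nonneg) (fun _ ↦ b.le_one) (fun ξ hξ ↦ ?_) hφ
      hsσ hσ).trans (mul_le_mul_of_nonneg_left hup (by positivity))
    obtain ⟨h1, h2, h3⟩ := hsupp ξ hξ
    have h1' := sq_le_sq' (abs_le.1 h1).1 (abs_le.1 h1).2
    have h2' := sq_le_sq' (abs_le.1 h2).1 (abs_le.1 h2).2
    have h3' := sq_le_sq' (abs_le.1 h3).1 (abs_le.1 h3).2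
    unfold dot3
    nlinarith
  have hφ' := h φ
  set S : ℝ → ℝ := fun x ↦ ⨆ (y : ℝ) (z : ℝ) (t : Set.Icc (0 : ℝ) T),
    (t : ℝ) ^ α * ‖U3 φ t (x, y, z)‖
  have hS (x) (hx : x ∈ Set.Icc (-(2 * N)⁻¹) (2 * N)⁻¹) : (4 * N ^ 3 * T ^ α) ^ 2 ≤ S x ^ 2 := by
    refine pow_le_pow_left₀ (by positivity) (le_trans ?_ (hSle x)) 2
    rw [mul_comm]
    refine mul_le_mul_of_nonneg_left (le_trans (by linarith) (half_integral_le_norm_zkOsc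
      b.continuous hbi (fun _ ↦ b.nonneg) fun ξ hξ ↦ ?_)) (by positivity)
    rw [abs_mul]
    calc |x| * |ξ.1| ≤ (2 * N)⁻¹ * (2 * N) :=
          mul_le_mul (abs_le.2 hx) (hsupp ξ hξ).1 (abs_nonneg _) (by positivity)
      _ = 1 := inv_mul_cancel₀ (by positivity)
  have hle : (4 * N ^ 3 * T ^ α) ^ 2 * N⁻¹ ≤ ∫ x, S x ^ 2 := by
    have h1 := setIntegral_ge_of_const_le_real measurableSet_Icc (by simp) hS hSi.integrableOn
    have h2 : volume.real (Set.Icc (-(2 * N)⁻¹) (2 * N)⁻¹) = N⁻¹ := by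
      rw [Real.volume_real_Icc_of_le (by linarith [show 0 ≤ (2 * N)⁻¹ by positivity])]
      field_simp
      ring
    rw [h2] at h1
    exact h1.trans (setIntegral_le_integral hSi (Filter.Eventually.of_forall fun x ↦ sq_nonneg _))
  calc _ ≤ ∫ x, S x ^ 2 := hle
    _ = √(∫ x, S x ^ 2) ^ 2 := (Real.sq_sqrt (integral_nonneg fun x ↦ sq_nonneg _)).symm
    _ ≤ (C * HsNorm s φ) ^ 2 := pow_le_pow_left₀ (Real.sqrt_nonneg _) hφ' 2
    _ = C ^ 2 * HsNorm s φ ^ 2 := mul_pow _ _ _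
    _ ≤ _ := mul_le_mul_of_nonneg_left hHs (sq_nonneg C)

/-- Proposition 3.6 (sharpness): if ‖t^α U(t)φ‖_{L²_x L^∞_{yzT}} ≤ C ‖φ‖_{H^s} for all Schwartz φ,
with T ∈ (0,1), α ≥ 0, then s ≥ 1. -/
theorem maximal_sharp (T α s : ℝ) (hT0 : 0 < T) (hT1 : T < 1) (hα : 0 ≤ α)
    (C : ℝ) (hC : 0 < C)
    (h : ∀ φ : SchwartzMap (ℝ × ℝ × ℝ) ℂ,
      Real.sqrt (∫ x : ℝ, (⨆ (y : ℝ) (z : ℝ) (t : Set.Icc (0:ℝ) T),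
          (t : ℝ) ^ α * ‖U3 (⇑φ) (t : ℝ) (x, y, z)‖) ^ 2)
        ≤ C * HsNorm s (⇑φ)) :
    1 ≤ s := by
  by_contra! hs
  obtain ⟨σ, hsσ, hσ0, hσ1⟩ : ∃ σ : ℝ, s ≤ σ ∧ 0 ≤ σ ∧ σ < 1 :=
    ⟨max s 0, le_max_left _ _, le_max_right _ _, max_lt hs one_pos⟩
  have hTα : 0 < T ^ α := Real.rpow_pos_of_pos hT0 α
  have hbound (N : ℝ) (hN : 1 ≤ N) : N ^ (2 - 2 * σ) ≤ 4 * C ^ 2 * 13 ^ σ / (T ^ α) ^ 2 := by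
    have hN0 : 0 < N := by linarith
    have key := maximal_test hT0 hT1 hα h hsσ hσ0 hN
    rw [Real.mul_rpow (by norm_num) (by positivity), ← Real.rpow_natCast_mul hN0.le] at key
    rw [Real.rpow_sub hN0, div_le_div_iff₀ (by positivity) (by positivity), Real.rpow_two]
    push_cast at key
    have h1 : (4 * N ^ 3 * T ^ α) ^ 2 * N⁻¹ = 16 * N ^ 3 * (N ^ 2 * (T ^ α) ^ 2) := by
      field_simp; ring
    rw [h1] at key
    refine le_of_mul_le_mul_left (key.trans_eq ?_) (by positivity : 0 < 16 * N ^ 3)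
    ring
  have htend := tendsto_rpow_atTop (show 0 < 2 - 2 * σ by linarith)
  obtain ⟨N, hN1, hN⟩ := ((Filter.eventually_ge_atTop 1).and (htend.eventually_gt_atTop
    (4 * C ^ 2 * 13 ^ σ / (T ^ α) ^ 2))).exists
  exact absurd (hbound N hN1) (not_le.2 hN)
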